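/- (Lower bound on observation entropy, Proposition 1.) Let P ∈ ℝ^{m₁×m₁} and Q ∈ ℝ^{m₂×m₂} be symmetric idempotent, σ² > 0, η² > 0, and let Ω = ((i₁,j₁),…,(i_N,j_N)) be a sequence of N ≥ 2 pairwise distinct indices. Then the N-th root of the observational entropy H(Ω) = det(σ² R_N(Ω) + η² I) satisfies H(Ω)^{1/N} ≥ min_{n=1,…,N} [ σ² P_{i_n,i_n} Q_{j_n,j_n} + η² − (σ²(N−1)/2) · ( max_{n'≠n} P_{i_n,i_{n'}}² + max_{n'≠n} Q_{j_n,j_{n'}}² ) ]. -/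

import Mathlib

open Matrix

noncomputable section

/-- The design covariance matrix `R_N(Ω)` with entries `P_{i_n,i_{n'}} Q_{j_n,j_{n'}}`. -/
def designR {m₁ m₂ N : ℕ} (P : Matrix (Fin m₁) (Fin m₁) ℝ) (Q : Matrix (Fin m₂) (Fin m₂) ℝ)
    (Ω : Fin N → Fin m₁ × Fin m₂) : Matrix (Fin N) (Fin N) ℝ :=
  Matrix.of fun n n' => P (Ω n).1 (Ω n').1 * Q (Ω n).2 (Ω n').2

/-- The cross-coherence vector `ν_{k,l}(Ω)` with `n`-th entry `P_{k,i_n} Q_{l,j_n}`. -/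
def nuVec {m₁ m₂ N : ℕ} (P : Matrix (Fin m₁) (Fin m₁) ℝ) (Q : Matrix (Fin m₂) (Fin m₂) ℝ)
    (Ω : Fin N → Fin m₁ × Fin m₂) (k : Fin m₁) (l : Fin m₂) : Fin N → ℝ :=
  fun n => P k (Ω n).1 * Q l (Ω n).2

/-- Conditional variance formula `v_Ω(k,l)`. -/
def condVar {m₁ m₂ N : ℕ} (σ2 γ2 : ℝ) (P : Matrix (Fin m₁) (Fin m₁) ℝ)
    (Q : Matrix (Fin m₂) (Fin m₂) ℝ) (Ω : Fin N → Fin m₁ × Fin m₂)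
    (k : Fin m₁) (l : Fin m₂) : ℝ :=
  σ2 * (P k k * Q l l -
    nuVec P Q Ω k l ⬝ᵥ ((designR P Q Ω + γ2 • (1 : Matrix (Fin N) (Fin N) ℝ))⁻¹ *ᵥ nuVec P Q Ω k l))

/-- Conditional covariance formula `c_Ω((i,j),(k,l))`. -/
def condCov {m₁ m₂ N : ℕ} (σ2 γ2 : ℝ) (P : Matrix (Fin m₁) (Fin m₁) ℝ)
    (Q : Matrix (Fin m₂) (Fin m₂) ℝ) (Ω : Fin N → Fin m₁ × Fin m₂)
    (i k : Fin m₁) (j l : Fin m₂) : ℝ :=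
  σ2 * (P i k * Q j l -
    nuVec P Q Ω i j ⬝ᵥ ((designR P Q Ω + γ2 • (1 : Matrix (Fin N) (Fin N) ℝ))⁻¹ *ᵥ nuVec P Q Ω k l))

/-- Observational entropy `H(Ω) = det(σ² R_N(Ω) + η² I)`. -/
def obsEntropy {m₁ m₂ N : ℕ} (σ2 η2 : ℝ) (P : Matrix (Fin m₁) (Fin m₁) ℝ)
    (Q : Matrix (Fin m₂) (Fin m₂) ℝ) (Ω : Fin N → Fin m₁ × Fin m₂) : ℝ :=
  (σ2 • designR P Q Ω + η2 • (1 : Matrix (Fin N) (Fin N) ℝ)).det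

/-- Sequential criterion `H((i,j)|Ω)`. -/
def seqCrit {m₁ m₂ N : ℕ} (γ2 : ℝ) (P : Matrix (Fin m₁) (Fin m₁) ℝ)
    (Q : Matrix (Fin m₂) (Fin m₂) ℝ) (Ω : Fin N → Fin m₁ × Fin m₂)
    (i : Fin m₁) (j : Fin m₂) : ℝ :=
  P i i * Q j j -
    nuVec P Q Ω i j ⬝ᵥ ((designR P Q Ω + γ2 • (1 : Matrix (Fin N) (Fin N) ℝ))⁻¹ *ᵥ nuVec P Q Ω i j)


/-- Gershgorin lower bound for the eigenvalues of a Hermitian matrix. -/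
theorem Matrix.IsHermitian.le_eigenvalues_of_le_diag_sub_sum {n : Type*} [Fintype n]
    [DecidableEq n] {A : Matrix n n ℝ} (hA : A.IsHermitian) {c : ℝ}
    (h : ∀ k, c ≤ A k k - ∑ j ∈ Finset.univ.erase k, ‖A k j‖) (i : n) :
    c ≤ hA.eigenvalues i := by
  have hev : Module.End.HasEigenvalue (Matrix.toLin' A) (hA.eigenvalues i) := by
    rw [Module.End.hasEigenvalue_iff_mem_spectrum, Matrix.spectrum_toLin']
    exact hA.eigenvalues_mem_spectrum_real i
  obtain ⟨k, hk⟩ := eigenvalue_mem_ball hev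
  rw [Metric.mem_closedBall, Real.dist_eq] at hk
  linarith [(abs_le.mp hk).1, h k]

/-- Gershgorin lower bound for the normalized determinant of a positive semidefinite matrix. -/
theorem Matrix.PosSemidef.le_det_rpow_of_le_diag_sub_sum {n : Type*} [Fintype n]
    [DecidableEq n] [Nonempty n] {A : Matrix n n ℝ} (hA : A.PosSemidef) {c : ℝ}
    (h : ∀ k, c ≤ A k k - ∑ j ∈ Finset.univ.erase k, ‖A k j‖) :
    c ≤ A.det ^ ((Fintype.card n : ℝ)⁻¹) := by
  rcases le_or_gt c 0 with hc | hc
  · exact hc.trans (Real.rpow_nonneg hA.det_nonneg _)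
  · have hdet : c ^ Fintype.card n ≤ A.det := by
      rw [hA.isHermitian.det_eq_prod_eigenvalues, ← Finset.card_univ, ← Finset.prod_const]
      exact Finset.prod_le_prod (fun _ _ => hc.le)
        fun i _ => hA.isHermitian.le_eigenvalues_of_le_diag_sub_sum h i
    calc c = (c ^ Fintype.card n) ^ ((Fintype.card n : ℝ)⁻¹) :=
          (Real.pow_rpow_inv_natCast hc.le Fintype.card_ne_zero).symm
      _ ≤ A.det ^ ((Fintype.card n : ℝ)⁻¹) :=
          Real.rpow_le_rpow (by positivity) hdet (by positivity)

theorem Matrix.posSemidef_of_transpose_eq_of_mul_self {n : Type*} [Fintype n]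
    {P : Matrix n n ℝ} (hsymm : Pᵀ = P) (hidem : P * P = P) : P.PosSemidef := by
  have h := Matrix.posSemidef_conjTranspose_mul_self P
  rwa [Matrix.conjTranspose_eq_transpose_of_trivial, hsymm, hidem] at h

theorem designR_posSemidef {m₁ m₂ N : ℕ} {P : Matrix (Fin m₁) (Fin m₁) ℝ}
    {Q : Matrix (Fin m₂) (Fin m₂) ℝ} (hP : P.PosSemidef) (hQ : Q.PosSemidef)
    (Ω : Fin N → Fin m₁ × Fin m₂) : (designR P Q Ω).PosSemidef :=
  (hP.submatrix fun n => (Ω n).1).hadamard (hQ.submatrix fun n => (Ω n).2)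

theorem sum_norm_offDiag_le {m₁ m₂ N : ℕ} (P : Matrix (Fin m₁) (Fin m₁) ℝ)
    (Q : Matrix (Fin m₂) (Fin m₂) ℝ) {σ2 : ℝ} (hσ2 : 0 < σ2) (η2 : ℝ)
    (Ω : Fin N → Fin m₁ × Fin m₂) (k : Fin N) {a b : ℝ}
    (ha : ∀ j ∈ Finset.univ.erase k, P (Ω k).1 (Ω j).1 ^ 2 ≤ a)
    (hb : ∀ j ∈ Finset.univ.erase k, Q (Ω k).2 (Ω j).2 ^ 2 ≤ b) :
    ∑ j ∈ Finset.univ.erase k,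
      ‖(σ2 • designR P Q Ω + η2 • (1 : Matrix (Fin N) (Fin N) ℝ)) k j‖ ≤
        σ2 * (N - 1) / 2 * (a + b) := by
  have hterm : ∀ j ∈ Finset.univ.erase k,
      ‖(σ2 • designR P Q Ω + η2 • (1 : Matrix (Fin N) (Fin N) ℝ)) k j‖ ≤
        σ2 * ((a + b) / 2) := fun j hj => by
    have hjk : k ≠ j := (Finset.ne_of_mem_erase hj).symm
    have hentry : ‖(σ2 • designR P Q Ω + η2 • (1 : Matrix (Fin N) (Fin N) ℝ)) k j‖ =
        σ2 * (|P (Ω k).1 (Ω j).1| * |Q (Ω k).2 (Ω j).2|) := by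
      simp [designR, hjk, abs_of_pos hσ2]
    have hamgm := two_mul_le_add_sq |P (Ω k).1 (Ω j).1| |Q (Ω k).2 (Ω j).2|
    rw [sq_abs, sq_abs] at hamgm
    rw [hentry]
    refine mul_le_mul_of_nonneg_left ?_ hσ2.le
    linarith [ha j hj, hb j hj]
  refine (Finset.sum_le_card_nsmul _ _ _ hterm).trans_eq ?_
  rw [Finset.card_erase_of_mem (Finset.mem_univ k), Finset.card_univ, Fintype.card_fin,
    nsmul_eq_mul, Nat.cast_pred k.pos]
  ring

/-- **Lower bound on observation entropy, Proposition 1.**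
For symmetric idempotent `P`, `Q` and `N ≥ 2` pairwise distinct indices,
`H(Ω)^{1/N} ≥ min_n [σ² μ_{i_n} μ_{j_n} + η² − (σ²(N−1)/2)(max_{n'≠n} ν_{i_n,i_{n'}}² +
max_{n'≠n} ν_{j_n,j_{n'}}²)]`. -/
theorem obsEntropy_root_lower_bound {m₁ m₂ N : ℕ} (hN : 2 ≤ N)
    (P : Matrix (Fin m₁) (Fin m₁) ℝ) (Q : Matrix (Fin m₂) (Fin m₂) ℝ)
    (hPsymm : Pᵀ = P) (hPidem : P * P = P)
    (hQsymm : Qᵀ = Q) (hQidem : Q * Q = Q)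
    (σ2 η2 : ℝ) (hσ2 : 0 < σ2) (hη2 : 0 < η2)
    (Ω : Fin N → Fin m₁ × Fin m₂) (hΩ : Function.Injective Ω) :
    (obsEntropy σ2 η2 P Q Ω) ^ ((N : ℝ)⁻¹) ≥
      Finset.univ.inf'
        ⟨⟨0, by omega⟩, Finset.mem_univ _⟩
        (fun n : Fin N =>
          σ2 * (P (Ω n).1 (Ω n).1 * Q (Ω n).2 (Ω n).2) + η2 -
            σ2 * (N - 1) / 2 *
              ((Finset.univ.erase n).sup'
                  (Finset.card_pos.mp (by
                    rw [Finset.card_erase_of_mem (Finset.mem_univ n), Finset.card_univ,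
                      Fintype.card_fin]
                    omega))
                  (fun n' => (P (Ω n).1 (Ω n').1) ^ 2) +
                (Finset.univ.erase n).sup'
                  (Finset.card_pos.mp (by
                    rw [Finset.card_erase_of_mem (Finset.mem_univ n), Finset.card_univ,
                      Fintype.card_fin]
                    omega))
                  (fun n' => (Q (Ω n).2 (Ω n').2) ^ 2))) := by
  have hA : (σ2 • designR P Q Ω + η2 • (1 : Matrix (Fin N) (Fin N) ℝ)).PosSemidef :=
    ((designR_posSemidef (posSemidef_of_transpose_eq_of_mul_self hPsymm hPidem)
      (posSemidef_of_transpose_eq_of_mul_self hQsymm hQidem) Ω).smul hσ2.le).add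
      (PosSemidef.one.smul hη2.le)
  have : Nonempty (Fin N) := ⟨⟨0, by omega⟩⟩
  rw [ge_iff_le, obsEntropy]
  have hbound {c : ℝ} := hA.le_det_rpow_of_le_diag_sub_sum (c := c)
  rw [Fintype.card_fin] at hbound
  refine hbound fun k => (Finset.inf'_le _ (Finset.mem_univ k)).trans ?_
  have hdiag : (σ2 • designR P Q Ω + η2 • (1 : Matrix (Fin N) (Fin N) ℝ)) k k =
      σ2 * (P (Ω k).1 (Ω k).1 * Q (Ω k).2 (Ω k).2) + η2 := by
    simp [designR]
  rw [hdiag]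
  refine sub_le_sub_left ?_ _
  exact sum_norm_offDiag_le P Q hσ2 η2 Ω k
    (fun _ hj => Finset.le_sup' (fun n' => P (Ω k).1 (Ω n').1 ^ 2) hj)
    fun _ hj => Finset.le_sup' (fun n' => Q (Ω k).2 (Ω n').2 ^ 2) hj

end
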